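/- (Localized interpolation inequality) Let n ≥ 1, 0 ≤ s < 1, r ∈ [1,∞], a ≥ 0, and 0 < θ ≤ 1. Then there exists C > 0, depending only on n, s, r, a, θ and Φ, such that for every k ∈ ℕ and every f ∈ 𝒮(ℝⁿ): ‖S_k f‖_{L^r_{⟨x⟩^a}} ≤ C 2^{kθ(1−s)} ‖J^{s−1} f‖_{L^r_{⟨x⟩^a}}^{θ} ‖f‖_{L^r_{⟨x⟩^a}}^{1−θ} and ‖∇(S_k f)‖_{L^r_{⟨x⟩^a}} ≤ C 2^{kθ(1−s)} ‖J^{s} f‖_{L^r_{⟨x⟩^a}}^{θ} ‖∇f‖_{L^r_{⟨x⟩^a}}^{1−θ}. -/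

import Mathlib

open MeasureTheory Real Complex
open scoped ENNReal NNReal RealInnerProductSpace

noncomputable section

abbrev Eu (n : ℕ) := EuclideanSpace ℝ (Fin n)

/-- The polynomial weight `⟨x⟩^a = (1+|x|²)^{a/2}` as an `ℝ≥0∞`-valued function. -/
def jweight {n : ℕ} (a : ℝ) (x : Eu n) : ℝ≥0∞ :=
  ENNReal.ofReal ((1 + ‖x‖ ^ 2) ^ (a / 2))

/-- Weighted Lebesgue (quasi-)norm `‖f‖_{L^p_{⟨x⟩^a}}`; for `p = ∞` the essential sup norm. -/
def wNorm {n : ℕ} {F : Type*} [NormedAddCommGroup F] (p : ℝ≥0∞) (a : ℝ)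
    (f : Eu n → F) : ℝ≥0∞ :=
  if p = ∞ then essSup (fun x => (‖f x‖₊ : ℝ≥0∞)) volume
  else (∫⁻ x, (‖f x‖₊ : ℝ≥0∞) ^ p.toReal * jweight a x) ^ (1 / p.toReal)

/-- The Fourier transform `f̂(ξ) = ∫ f(x) e^{-i x·ξ} dx`. -/
def FT {n : ℕ} (f : Eu n → ℂ) (ξ : Eu n) : ℂ :=
  ∫ x, f x * Complex.exp (-(Complex.I * ((⟪x, ξ⟫ : ℝ) : ℂ)))

/-- The inhomogeneous fractional derivative (Bessel potential) `J^s`. -/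
def Js {n : ℕ} (s : ℝ) (f : Eu n → ℂ) (x : Eu n) : ℂ :=
  ((((2 * Real.pi) ^ n)⁻¹ : ℝ) : ℂ) *
    ∫ ξ, (((1 + ‖ξ‖ ^ 2) ^ (s / 2) : ℝ) : ℂ) * FT f ξ *
      Complex.exp (Complex.I * ((⟪x, ξ⟫ : ℝ) : ℂ))

/-- The Euclidean norm `|∇f|(x)` of the gradient of a complex-valued function. -/
def gradNorm {n : ℕ} (f : Eu n → ℂ) (x : Eu n) : ℝ :=
  Real.sqrt (∑ j : Fin n, ‖fderiv ℝ f x (EuclideanSpace.single j 1)‖ ^ 2)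

/-- The "dot product" of gradients `∇f·∇g = Σ_j (∂_j f)(∂_j g)`. -/
def gradDot {n : ℕ} (f g : Eu n → ℂ) (x : Eu n) : ℂ :=
  ∑ j : Fin n, fderiv ℝ f x (EuclideanSpace.single j 1) *
    fderiv ℝ g x (EuclideanSpace.single j 1)

/-- A Littlewood–Paley bump: `Φ ∈ C_c^∞(ℝⁿ)` with `0 ≤ Φ ≤ 1`, `Φ = 1` on `|ξ| ≤ 1` and
`Φ = 0` on `|ξ| ≥ 2`. -/
def IsLPBump {n : ℕ} (Φ : Eu n → ℝ) : Prop :=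
  ContDiff ℝ (⊤ : ℕ∞) Φ ∧ (∀ ξ, 0 ≤ Φ ξ ∧ Φ ξ ≤ 1) ∧
    (∀ ξ, ‖ξ‖ ≤ 1 → Φ ξ = 1) ∧ (∀ ξ, 2 ≤ ‖ξ‖ → Φ ξ = 0)

/-- The low-frequency projection `S_k f`, with Fourier multiplier `Φ(2^{-k}ξ)`. -/
def SProj {n : ℕ} (Φ : Eu n → ℝ) (k : ℤ) (f : Eu n → ℂ) (x : Eu n) : ℂ :=
  ((((2 * Real.pi) ^ n)⁻¹ : ℝ) : ℂ) *
    ∫ ξ, ((Φ ((2 : ℝ) ^ (-k) • ξ) : ℝ) : ℂ) * FT f ξ *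
      Complex.exp (Complex.I * ((⟪x, ξ⟫ : ℝ) : ℂ))

/-- The Littlewood–Paley piece `Δ_k f = S_k f - S_{k-1} f`, with Fourier multiplier
`Ψ(2^{-k}ξ) = Φ(2^{-k}ξ) - Φ(2^{-(k-1)}ξ)`. -/
def DProj {n : ℕ} (Φ : Eu n → ℝ) (k : ℤ) (f : Eu n → ℂ) (x : Eu n) : ℂ :=
  SProj Φ k f x - SProj Φ (k - 1) f x

lemma peetre {n : ℕ} (x z : Eu n) :
    1 + ‖x‖ ^ 2 ≤ 2 * ((1 + ‖z‖ ^ 2) * (1 + ‖x - z‖ ^ 2)) := by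
  have h : ‖x‖ ≤ ‖z‖ + ‖x - z‖ := by
    simpa using norm_add_le z (x - z)
  have h0 := norm_nonneg x
  have h1 := norm_nonneg z
  have h2 := norm_nonneg (x - z)
  nlinarith [mul_nonneg (sq_nonneg ‖z‖) (sq_nonneg ‖x - z‖), sq_nonneg (‖z‖ - ‖x - z‖),
    mul_self_le_mul_self h0 h]

lemma jweight_peetre {n : ℕ} (a : ℝ) (ha : 0 ≤ a) (x z : Eu n) :
    jweight a x ≤ ENNReal.ofReal (2 ^ (a / 2)) * (jweight a z * jweight a (x - z)) := by
  unfold jweight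
  rw [← ENNReal.ofReal_mul (by positivity), ← ENNReal.ofReal_mul (by positivity)]
  apply ENNReal.ofReal_le_ofReal
  rw [← Real.mul_rpow (by positivity) (by positivity),
    ← Real.mul_rpow (by positivity) (by positivity)]
  exact Real.rpow_le_rpow (by positivity) (peetre x z) (by positivity)

lemma measurable_jweight {n : ℕ} (a : ℝ) : Measurable (jweight a : Eu n → ℝ≥0∞) := by
  unfold jweight
  fun_prop

lemma one_le_jweight {n : ℕ} (a : ℝ) (ha : 0 ≤ a) (x : Eu n) : 1 ≤ jweight a x := by
  unfold jweight
  rw [← ENNReal.ofReal_one]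
  apply ENNReal.ofReal_le_ofReal
  apply Real.one_le_rpow _ (by positivity)
  nlinarith [sq_nonneg ‖x‖]

lemma jensen_lint {α : Type*} [MeasurableSpace α] (μ : Measure α) (p : ℝ) (hp : 1 ≤ p)
    (A g : α → ℝ≥0∞) (hA : Measurable A) (hg : Measurable g) :
    (∫⁻ z, A z * g z ∂μ) ^ p ≤ (∫⁻ z, A z ∂μ) ^ (p - 1) * ∫⁻ z, A z * g z ^ p ∂μ := by
  rcases eq_or_lt_of_le hp with rfl | hp
  · simp
  have hpq : p.HolderConjugate (Real.conjExponent p) := Real.HolderConjugate.conjExponent hp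
  set q := Real.conjExponent p
  have hp0 : 0 < p := by linarith
  have hq0 : 0 < q := hpq.symm.pos
  have h := ENNReal.lintegral_mul_le_Lp_mul_Lq μ hpq
    (f := fun z => A z ^ (1 / p) * g z) (g := fun z => A z ^ (1 / q)) (by fun_prop) (by fun_prop)
  have e1 : ∀ z, A z ^ (1 / p) * g z * A z ^ (1 / q) = A z * g z := by
    intro z
    rw [mul_right_comm, ← ENNReal.rpow_add_of_nonneg _ _ (by positivity) (by positivity)]
    have : 1 / p + 1 / q = 1 := by simpa using hpq.inv_add_inv_eq_one
    rw [this, ENNReal.rpow_one]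
  have e2 : ∀ z, (A z ^ (1 / p) * g z) ^ p = A z * g z ^ p := by
    intro z
    rw [ENNReal.mul_rpow_of_nonneg _ _ hp0.le, ← ENNReal.rpow_mul, one_div_mul_cancel hp0.ne',
      ENNReal.rpow_one]
  have e3 : ∀ z, (A z ^ (1 / q)) ^ q = A z := by
    intro z
    rw [← ENNReal.rpow_mul, one_div_mul_cancel hq0.ne', ENNReal.rpow_one]
  simp only [Pi.mul_apply, e1, e2, e3] at h
  calc _ ≤ _ := ENNReal.rpow_le_rpow h hp0.le
    _ = _ := by
      rw [ENNReal.mul_rpow_of_nonneg _ _ hp0.le, ← ENNReal.rpow_mul, ← ENNReal.rpow_mul,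
        one_div_mul_cancel hp0.ne', ENNReal.rpow_one, mul_comm]
      congr 2
      have := hpq.symm.sub_one_mul_conj
      have h3 := hpq.sub_one_mul_conj
      field_simp
      linarith

lemma young {n : ℕ} {F G : Type*} [NormedAddCommGroup F] [NormedAddCommGroup G]
    (r : ℝ≥0∞) (hr : 1 ≤ r) (a : ℝ) (ha : 0 ≤ a)
    (u : Eu n → F) (v : Eu n → G) (hv : Continuous v) (A : Eu n → ℝ≥0∞) (hA : Measurable A)
    (h : ∀ x, ‖u x‖ₑ ≤ ∫⁻ z, A z * ‖v (x - z)‖ₑ) :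
    wNorm r a u ≤ ENNReal.ofReal (2 ^ (a / 2)) * (∫⁻ z, A z * jweight a z) * wNorm r a v := by
  have hC : 1 ≤ ENNReal.ofReal (2 ^ (a / 2)) := by
    rw [← ENNReal.ofReal_one]
    exact ENNReal.ofReal_le_ofReal (Real.one_le_rpow (by norm_num) (by positivity))
  have hW : ∫⁻ z, A z ≤ ∫⁻ z, A z * jweight a z :=
    lintegral_mono fun z => le_mul_of_one_le_right' (one_le_jweight a ha z)
  set C := ENNReal.ofReal (2 ^ (a / 2))
  set W := ∫⁻ z, A z * jweight a z
  obtain ⟨V, hVe⟩ : ∃ V : Eu n → ℝ≥0∞, ∀ x, ‖v x‖ₑ = V x := ⟨_, fun _ => rfl⟩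
  have hV : Measurable V := by
    have : V = fun x => ‖v x‖ₑ := funext fun x => (hVe x).symm
    rw [this]; exact hv.enorm.measurable
  unfold wNorm
  change _ ≤ _ * if r = ∞ then essSup (fun x => ‖v x‖ₑ) volume
    else (∫⁻ x, ‖v x‖ₑ ^ r.toReal * jweight a x) ^ (1 / r.toReal)
  simp only [hVe] at h ⊢
  by_cases hrt : r = ∞
  · simp only [hrt, if_true]
    have h1 : ∀ x, ‖u x‖ₑ ≤ W * essSup (fun x => V x) volume := by
      intro x
      refine (h x).trans ?_
      calc _ ≤ ∫⁻ z, A z * essSup (fun x => V x) volume := by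
            apply lintegral_mono_ae
            have h2 := ae_le_essSup (μ := (volume : Measure (Eu n))) (f := fun x => V x)
            have h3 := (Measure.measurePreserving_sub_left (volume : Measure (Eu n)) x).quasiMeasurePreserving.ae h2
            filter_upwards [h3] with z hz
            gcongr
        _ = (∫⁻ z, A z) * _ := lintegral_mul_const _ hA
        _ ≤ _ := by gcongr
    calc _ ≤ W * essSup (fun x => V x) volume := essSup_le_of_ae_le _ (Filter.Eventually.of_forall h1)
      _ ≤ C * W * essSup (fun x => V x) volume := by
          rw [mul_assoc]
          exact le_mul_of_one_le_left' hC
  · simp only [hrt, if_false]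
    set p := r.toReal
    have hp : 1 ≤ p := by
      have := ENNReal.toReal_mono hrt hr
      simpa using this
    have hp0 : 0 < p := by linarith
    change (∫⁻ x, ‖u x‖ₑ ^ p * jweight a x) ^ (1 / p) ≤ C * W * (∫⁻ x, V x ^ p * jweight a x) ^ (1 / p)
    set N := ∫⁻ x, V x ^ p * jweight a x
    have hVs : Measurable fun q : Eu n × Eu n => V (q.1 - q.2) := hV.comp (measurable_fst.sub measurable_snd)
    have hjm := measurable_jweight (n := n) a
    have key : ∫⁻ x, ‖u x‖ₑ ^ p * jweight a x ≤ (C * W) ^ p * N := by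
      calc ∫⁻ x, ‖u x‖ₑ ^ p * jweight a x
          ≤ ∫⁻ x, (∫⁻ z, A z) ^ (p - 1) * ∫⁻ z, C * ((A z * jweight a z) * (V (x - z) ^ p * jweight a (x - z))) := by
            apply lintegral_mono
            intro x
            calc ‖u x‖ₑ ^ p * jweight a x ≤ (∫⁻ z, A z * V (x - z)) ^ p * jweight a x := by
                  gcongr; exact h x
              _ ≤ (∫⁻ z, A z) ^ (p - 1) * (∫⁻ z, A z * V (x - z) ^ p) * jweight a x := by
                  gcongr
                  exact jensen_lint _ p hp A _ hA (by fun_prop)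
              _ = (∫⁻ z, A z) ^ (p - 1) * ∫⁻ z, A z * V (x - z) ^ p * jweight a x := by
                  rw [mul_assoc, lintegral_mul_const _ (by fun_prop)]
              _ ≤ _ := by
                  refine mul_le_mul_right (lintegral_mono fun z => ?_) _
                  calc _ ≤ A z * V (x - z) ^ p * (C * (jweight a z * jweight a (x - z))) := by
                        gcongr; exact jweight_peetre a ha x z
                    _ = _ := by ring
        _ = (∫⁻ z, A z) ^ (p - 1) * (C * ∫⁻ z, (A z * jweight a z) * N) := by
            rw [lintegral_const_mul _ (by fun_prop)]
            congr 1
            have : ∀ x, ∫⁻ z, C * ((A z * jweight a z) * (V (x - z) ^ p * jweight a (x - z))) =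
              C * ∫⁻ z, ((A z * jweight a z) * (V (x - z) ^ p * jweight a (x - z))) := by
                intro x
                rw [lintegral_const_mul _ (by fun_prop)]
            simp_rw [this]
            rw [lintegral_const_mul _ (by fun_prop)]
            congr 1
            rw [lintegral_lintegral_swap (by fun_prop)]
            congr 1
            ext z
            rw [lintegral_const_mul _ (by fun_prop)]
            congr 1
            exact lintegral_sub_right_eq_self (fun x => V x ^ p * jweight a x) z
        _ = (∫⁻ z, A z) ^ (p - 1) * (C * (W * N)) := by
            rw [lintegral_mul_const _ (by fun_prop)]
        _ ≤ W ^ (p - 1) * (C ^ p * (W * N)) := by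
            gcongr
            calc C = C ^ (1 : ℝ) := by simp
              _ ≤ _ := ENNReal.rpow_le_rpow_of_exponent_le hC hp
        _ = (C * W) ^ p * N := by
            rw [ENNReal.mul_rpow_of_nonneg _ _ hp0.le]
            have : W ^ p = W ^ (p - 1) * W := by
              conv_rhs => rw [← ENNReal.rpow_one W, ← ENNReal.rpow_mul, one_mul,
                ← ENNReal.rpow_add_of_nonneg _ _ (by linarith) (by norm_num)]
              simp
            rw [this]; ring
    calc _ ≤ ((C * W) ^ p * N) ^ (1 / p) := ENNReal.rpow_le_rpow key (by positivity)
      _ = _ := by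
        rw [ENNReal.mul_rpow_of_nonneg _ _ (by positivity), ← ENNReal.rpow_mul,
          mul_one_div_cancel hp0.ne', ENNReal.rpow_one]

open scoped SchwartzMap FourierTransform Convolution
open SchwartzMap

lemma weight_bdd {n : ℕ} (a : ℝ) (ha : 0 ≤ a) (B : Set 𝓢(Eu n, ℂ))
    (hB : Bornology.IsVonNBounded ℝ B) :
    ∃ C : ℝ, 0 ≤ C ∧ ∀ m ∈ B,
      ∫⁻ z, ‖(𝓕⁻ m : 𝓢(Eu n, ℂ)) z‖ₑ * jweight a z ≤ ENNReal.ofReal C := by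
  have hB2 := hB.image (FourierTransform.fourierInvCLM ℝ 𝓢(Eu n, ℂ))
  obtain ⟨N, hN⟩ := exists_nat_gt (a + n)
  have hS := (schwartz_withSeminorms ℝ (Eu n) ℂ).isVonNBounded_iff_finset_seminorm_bounded.1 hB2
    (Finset.Iic (N, 0))
  obtain ⟨R, hR, hRB⟩ := hS
  have hint : Integrable (fun z : Eu n => (1 + ‖z‖) ^ (-((N : ℝ) - a))) :=
    integrable_one_add_norm (by simp; linarith)
  refine ⟨∫ z : Eu n, 2 ^ N * R * (1 + ‖z‖) ^ (-((N : ℝ) - a)),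
    integral_nonneg fun z => by positivity, fun m hm => ?_⟩
  rw [ofReal_integral_eq_lintegral_ofReal (hint.const_mul _)
    (Filter.Eventually.of_forall fun z => by positivity)]
  apply lintegral_mono
  intro z
  have h1 := one_add_le_sup_seminorm_apply (𝕜 := ℝ) (m := (N, 0)) (k := N) (n := 0) le_rfl le_rfl
    (𝓕⁻ m) z
  have h2 := hRB (𝓕⁻ m) ⟨m, hm, rfl⟩
  have h3 : (1 + ‖z‖) ^ N * ‖(𝓕⁻ m) z‖ ≤ 2 ^ N * R := by
    rw [norm_iteratedFDeriv_zero] at h1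
    refine h1.trans ?_
    have := h2.le
    gcongr
    exact this
  unfold jweight
  beta_reduce
  rw [← ofReal_norm, ← ENNReal.ofReal_mul (norm_nonneg _)]
  apply ENNReal.ofReal_le_ofReal
  have hz : 0 < 1 + ‖z‖ := by positivity
  have h4 : (1 + ‖z‖ ^ 2) ^ (a / 2) ≤ (1 + ‖z‖) ^ a := by
    calc (1 + ‖z‖ ^ 2) ^ (a / 2) ≤ ((1 + ‖z‖) ^ (2 : ℝ)) ^ (a / 2) := by
          apply Real.rpow_le_rpow (by positivity) _ (by positivity)
          rw [Real.rpow_two]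
          nlinarith [norm_nonneg z]
      _ = _ := by rw [← Real.rpow_mul hz.le]; congr 1; ring
  have h5 : (1 + ‖z‖) ^ (-((N : ℝ) - a)) = (1 + ‖z‖) ^ a / (1 + ‖z‖) ^ N := by
    rw [neg_sub, Real.rpow_sub hz, Real.rpow_natCast]
  rw [h5]
  calc _ ≤ ‖(𝓕⁻ m) z‖ * (1 + ‖z‖) ^ a := by gcongr
    _ = ((1 + ‖z‖) ^ N * ‖(𝓕⁻ m) z‖) * ((1 + ‖z‖) ^ a / (1 + ‖z‖) ^ N) := by
        field_simp
    _ ≤ _ := by gcongr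

/-- Kernel bound. -/
def KB {n : ℕ} (a : ℝ) (T : 𝓢(Eu n, ℂ) → 𝓢(Eu n, ℂ)) (B : ℝ≥0∞) : Prop :=
  ∃ A : Eu n → ℝ≥0∞, Measurable A ∧ (∀ h x, ‖T h x‖ₑ ≤ ∫⁻ z, A z * ‖h (x - z)‖ₑ) ∧
    ∫⁻ z, A z * jweight a z ≤ B

lemma KB.mono {n : ℕ} {a : ℝ} {T : 𝓢(Eu n, ℂ) → 𝓢(Eu n, ℂ)} {B B' : ℝ≥0∞} (h : KB a T B)
    (hB : B ≤ B') : KB a T B' := by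
  obtain ⟨A, h1, h2, h3⟩ := h
  exact ⟨A, h1, h2, h3.trans hB⟩

lemma KB.add {n : ℕ} {a : ℝ} {T S R : 𝓢(Eu n, ℂ) → 𝓢(Eu n, ℂ)} {B B' : ℝ≥0∞} (h : KB a T B)
    (h' : KB a S B') (hR : ∀ f x, R f x = T f x + S f x) : KB a R (B + B') := by
  obtain ⟨A, h1, h2, h3⟩ := h
  obtain ⟨A', h1', h2', h3'⟩ := h'
  refine ⟨A + A', h1.add h1', fun f x => ?_, ?_⟩
  · rw [hR]
    refine (enorm_add_le _ _).trans ?_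
    simp only [Pi.add_apply, add_mul]
    have hfm : Measurable fun z => ‖f (x - z)‖ₑ := by
      have := f.continuous
      exact Continuous.measurable (by fun_prop)
    rw [lintegral_add_left (by fun_prop)]
    exact add_le_add (h2 f x) (h2' f x)
  · simp only [Pi.add_apply, add_mul]
    have := measurable_jweight (n := n) a
    rw [lintegral_add_left (by fun_prop)]
    exact add_le_add h3 h3'

lemma KB.smul {n : ℕ} {a : ℝ} {T R : 𝓢(Eu n, ℂ) → 𝓢(Eu n, ℂ)} {B : ℝ≥0∞} (h : KB a T B)
    (c : ℝ) (hc : 0 ≤ c)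
    (hR : ∀ f x, R f x = c * T f x) : KB a R (ENNReal.ofReal c * B) := by
  obtain ⟨A, h1, h2, h3⟩ := h
  refine ⟨fun z => ENNReal.ofReal c * A z, by fun_prop, fun f x => ?_, ?_⟩
  · rw [hR, enorm_mul]
    simp only [mul_assoc]
    have hfm : Measurable fun z => ‖f (x - z)‖ₑ := by
      have := f.continuous
      exact Continuous.measurable (by fun_prop)
    rw [lintegral_const_mul _ (by fun_prop)]
    gcongr
    · rw [← ofReal_norm]
      simp [abs_of_nonneg hc]
    · exact h2 f x
  · simp only [mul_assoc]
    have := measurable_jweight (n := n) a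
    rw [lintegral_const_mul _ (by fun_prop)]
    gcongr

lemma fourierInv_dil {n : ℕ} (m : Eu n → ℂ) (c : ℝ) (hc : 0 < c) (z : Eu n) :
    𝓕⁻ (fun η => m (c • η)) z = ((c ^ n)⁻¹ : ℝ) • 𝓕⁻ m (c⁻¹ • z) := by
  rw [Real.fourierInv_eq, Real.fourierInv_eq]
  have := Measure.integral_comp_smul (volume : Measure (Eu n))
    (fun v => Real.fourierChar (inner ℝ v (c⁻¹ • z)) • m v) c
  simp only [finrank_euclideanSpace, Fintype.card_fin] at this
  rw [abs_of_pos (by positivity)] at this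
  rw [← this]
  congr 1
  ext v
  rw [inner_smul_left, inner_smul_right]
  simp [mul_inv_cancel_left₀ hc.ne']

lemma mult_conv {n : ℕ} (m h : 𝓢(Eu n, ℂ)) (x : Eu n) :
    fourierMultiplierCLM ℂ (m : Eu n → ℂ) h x = ∫ z, (𝓕⁻ m) z * h (x - z) := by
  have h1 := convolution_apply (ContinuousLinearMap.mul ℂ ℂ) (𝓕⁻ m) h x
  rw [MeasureTheory.convolution] at h1
  simp only [ContinuousLinearMap.mul_apply'] at h1
  rw [← h1]
  congr 1
  have hc : convolution (ContinuousLinearMap.mul ℂ ℂ) (𝓕⁻ m) h =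
      𝓕⁻ (pairing (ContinuousLinearMap.mul ℂ ℂ) (𝓕 (𝓕⁻ m)) (𝓕 h)) := rfl
  rw [hc, fourierMultiplierCLM_apply, FourierTransform.fourier_fourierInv_eq]
  congr 1
  ext y
  rw [smulLeftCLM_apply_apply m.hasTemperateGrowth]
  rfl

lemma KB_dil {n : ℕ} (a : ℝ) (ha : 0 ≤ a) (m : 𝓢(Eu n, ℂ)) (c : ℝ) (hc : 0 < c) (hc1 : c ≤ 1)
    {B : ℝ≥0∞} (hB : ∫⁻ z, ‖(𝓕⁻ m : 𝓢(Eu n, ℂ)) z‖ₑ * jweight a z ≤ B) :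
    KB a (fourierMultiplierCLM ℂ (fun η => m (c • η))) B := by
  let m' : 𝓢(Eu n, ℂ) := compCLMOfContinuousLinearEquiv ℂ
    (ContinuousLinearEquiv.smulLeft (Units.mk0 c hc.ne')) m
  have hm' : (m' : Eu n → ℂ) = fun η => m (c • η) := rfl
  have hF : ∀ z, (𝓕⁻ m') z = ((c ^ n)⁻¹ : ℝ) • (𝓕⁻ m) (c⁻¹ • z) := by
    intro z
    rw [fourierInv_coe, hm', fourierInv_dil _ c hc, fourierInv_coe]
  refine ⟨fun z => ‖(𝓕⁻ m') z‖ₑ, (𝓕⁻ m').continuous.enorm.measurable, fun h x => ?_, ?_⟩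
  · rw [← hm', mult_conv]
    refine (enorm_integral_le_lintegral_enorm _).trans ?_
    simp [enorm_mul]
  · refine le_trans ?_ hB
    have hjm := measurable_jweight (n := n) a
    have hKm : Measurable fun z => ‖(𝓕⁻ m) z‖ₑ := (𝓕⁻ m).continuous.enorm.measurable
    have hci : c⁻¹ ≠ 0 := by positivity
    have key : ∫⁻ z, ‖(𝓕⁻ m) (c⁻¹ • z)‖ₑ * jweight a (c⁻¹ • z) =
        ENNReal.ofReal (c ^ n) * ∫⁻ z, ‖(𝓕⁻ m) z‖ₑ * jweight a z := by
      have h1 := Measure.map_addHaar_smul (volume : Measure (Eu n)) hci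
      have h2 := lintegral_map (μ := (volume : Measure (Eu n)))
        (f := fun z : Eu n => ‖(𝓕⁻ m : 𝓢(Eu n, ℂ)) z‖ₑ * jweight a z)
        (g := fun z : Eu n => c⁻¹ • z) (by fun_prop) (by fun_prop)
      rw [← h2, h1, lintegral_smul_measure]
      simp [abs_of_pos hc]
    calc _ ≤ ∫⁻ z, ENNReal.ofReal ((c ^ n)⁻¹) * (‖(𝓕⁻ m) (c⁻¹ • z)‖ₑ * jweight a (c⁻¹ • z)) := by
          apply lintegral_mono
          intro z
          simp only [hF]
          rw [enorm_smul, mul_assoc, ← ofReal_norm, Real.norm_of_nonneg (by positivity)]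
          gcongr
          unfold jweight
          apply ENNReal.ofReal_le_ofReal
          gcongr
          rw [norm_smul, Real.norm_of_nonneg (by positivity)]
          exact le_mul_of_one_le_left (norm_nonneg _) (one_le_inv₀ hc |>.2 hc1)
      _ = _ := by
          rw [lintegral_const_mul' _ _ ENNReal.ofReal_ne_top, key, ← mul_assoc,
            ← ENNReal.ofReal_mul (by positivity), inv_mul_cancel₀ (by positivity)]
          simp
open scoped ContDiff in
lemma bdd_family {n : ℕ} (M : ℝ × Eu n → ℂ) (hM : ContDiff ℝ ∞ M)
    (h0 : ∀ ε η, 1 ≤ ‖η‖ → M (ε, η) = 0) :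
    ∃ m : ℝ → 𝓢(Eu n, ℂ), (∀ ε η, m ε η = M (ε, η)) ∧
      Bornology.IsVonNBounded ℝ (m '' Set.Icc 0 1) := by
  have hts : ∀ ε : ℝ, tsupport (fun η => M (ε, η)) ⊆ Metric.closedBall 0 1 := by
    intro ε
    apply closure_minimal _ Metric.isClosed_closedBall
    intro η hη
    by_contra hc
    simp only [Metric.mem_closedBall, dist_zero_right, not_le] at hc
    exact hη (h0 ε η hc.le)
  have hcs : ∀ ε : ℝ, HasCompactSupport (fun η => M (ε, η)) := fun ε =>
    (isCompact_closedBall (0 : Eu n) 1).of_isClosed_subset (isClosed_tsupport _) (hts ε)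
  have hsm : ∀ ε : ℝ, ContDiff ℝ ∞ (fun η => M (ε, η)) := fun ε => by fun_prop
  refine ⟨fun ε => (hcs ε).toSchwartzMap (hsm ε), fun ε η => rfl, ?_⟩
  rw [(schwartz_withSeminorms ℝ (Eu n) ℂ).isVonNBounded_iff_seminorm_bounded]
  rintro ⟨k, l⟩
  have hcont : Continuous (fun p => ‖iteratedFDeriv ℝ l M p‖) :=
    (hM.continuous_iteratedFDeriv (by exact_mod_cast le_top)).norm
  obtain ⟨C, hC⟩ := ((isCompact_Icc (a := (0 : ℝ)) (b := 1)).prod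
    (isCompact_closedBall (0 : Eu n) 1)).bddAbove_image hcont.continuousOn
  have hC' : ∀ ε ∈ Set.Icc (0 : ℝ) 1, ∀ η ∈ Metric.closedBall (0 : Eu n) 1,
      ‖iteratedFDeriv ℝ l M (ε, η)‖ ≤ C := fun ε hε η hη =>
    hC (Set.mem_image_of_mem _ (Set.mk_mem_prod hε hη))
  set I := ContinuousLinearMap.inr ℝ ℝ (Eu n)
  refine ⟨|C| * ‖I‖ ^ l + 1, by positivity, ?_⟩
  rintro _ ⟨ε, hε, rfl⟩
  refine lt_of_le_of_lt ?_ (lt_add_one _)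
  change SchwartzMap.seminorm ℝ k l _ ≤ _
  apply SchwartzMap.seminorm_le_bound _ _ _ _ (by positivity)
  intro η
  change ‖η‖ ^ k * ‖iteratedFDeriv ℝ l (fun η => M (ε, η)) η‖ ≤ _
  by_cases hη : η ∈ Metric.closedBall (0 : Eu n) 1
  · have h1 : (fun η => M (ε, η)) = (fun p => M ((ε, 0) + p)) ∘ I := by
      ext η; simp [I]
    have h2 : ‖iteratedFDeriv ℝ l (fun η => M (ε, η)) η‖ ≤ C * ‖I‖ ^ l := by
      rw [h1, ContinuousLinearMap.iteratedFDeriv_comp_right I (n := ∞) (by fun_prop) _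
        (by exact_mod_cast le_top), iteratedFDeriv_comp_add_left]
      refine (ContinuousMultilinearMap.norm_compContinuousLinearMap_le _ _).trans ?_
      simp only [Finset.prod_const, Finset.card_univ, Fintype.card_fin]
      gcongr
      have := hC' ε hε η hη
      simpa [I] using this
    have h3 : ‖η‖ ^ k ≤ 1 := pow_le_one₀ (norm_nonneg _) (by simpa using hη)
    calc _ ≤ 1 * (C * ‖I‖ ^ l) := by gcongr
      _ ≤ _ := by rw [one_mul]; gcongr; exact le_abs_self C
  · have : iteratedFDeriv ℝ l (fun η => M (ε, η)) η = 0 := by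
      by_contra hne
      exact hη (hts ε (support_iteratedFDeriv_subset l hne))
    rw [this]; simp; positivity

open scoped ContDiff in
/-- the dyadic symbol -/
lemma dyadic_symbol {n : ℕ} (Φ : Eu n → ℝ) (hΦ : IsLPBump Φ) (q : Eu n → ℂ) (hq : ContDiff ℝ ∞ q)
    (τ : ℝ) :
    ContDiff ℝ ∞ (fun p : ℝ × Eu n =>
      (((Φ ((2 * π) • p.2) - Φ ((4 * π) • p.2) : ℝ) : ℂ) * q p.2 *
        (((p.1 ^ 2 + ‖(2 * π) • p.2‖ ^ 2) ^ (τ / 2) : ℝ) : ℂ))) := by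
  obtain ⟨h1, h2, h3, h4⟩ := hΦ
  have h1' : ContDiff ℝ ∞ Φ := h1
  rw [contDiff_iff_contDiffAt]
  rintro ⟨ε, η⟩
  by_cases hη : ‖(4 * π) • η‖ < 1
  · apply ContDiffAt.congr_of_eventuallyEq (f := fun _ => (0 : ℂ)) contDiffAt_const
    have hopen : ∀ᶠ p : ℝ × Eu n in nhds (ε, η), ‖(4 * π) • p.2‖ < 1 := by
      apply (isOpen_lt (by fun_prop) continuous_const).mem_nhds hη
    filter_upwards [hopen] with p hp
    have hp2 : ‖(2 * π) • p.2‖ ≤ 1 := by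
      rw [norm_smul, Real.norm_of_nonneg (by positivity)] at hp ⊢
      nlinarith [norm_nonneg p.2, pi_pos, mul_nonneg pi_pos.le (norm_nonneg p.2)]
    rw [h3 _ hp.le, h3 _ hp2]
    simp
  · have hpos : (ε ^ 2 + ‖(2 * π) • η‖ ^ 2) ≠ 0 := by
      have : η ≠ 0 := by rintro rfl; simp at hη
      have : 0 < ‖(2 * π) • η‖ := by
        rw [norm_pos_iff]; simp [this, pi_ne_zero]
      positivity
    have hr : ContDiffAt ℝ ∞ (fun p : ℝ × Eu n => (p.1 ^ 2 + ‖(2 * π) • p.2‖ ^ 2) ^ (τ / 2)) (ε, η) := by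
      refine ContDiffAt.rpow_const_of_ne
        (f := fun p : ℝ × Eu n => p.1 ^ 2 + ‖(2 * π) • p.2‖ ^ 2) ?_ hpos
      apply ContDiff.contDiffAt
      apply ContDiff.add (by fun_prop)
      apply ContDiff.norm_sq ℝ
      fun_prop
    have ho : ContDiff ℝ ∞ (fun x : ℝ => (x : ℂ)) := ofRealCLM.contDiff
    apply ContDiffAt.mul
    · apply ContDiff.contDiffAt
      fun_prop
    · exact ho.contDiffAt.comp _ hr

lemma mult_add_smul {n : ℕ} {m m₁ m₂ : Eu n → ℂ} (h₁ : m₁.HasTemperateGrowth)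
    (h₂ : m₂.HasTemperateGrowth) (c : ℂ) (hm : ∀ η, m η = m₁ η + c * m₂ η) (f : 𝓢(Eu n, ℂ)) :
    fourierMultiplierCLM ℂ m f =
      fourierMultiplierCLM ℂ m₁ f + c • fourierMultiplierCLM ℂ m₂ f := by
  have e : m = m₁ + (fun _ => c) * m₂ := by ext η; simp [hm]
  have h : m.HasTemperateGrowth := by
    rw [e]
    exact h₁.add ((Function.HasTemperateGrowth.const c).mul h₂)
  simp only [fourierMultiplierCLM_apply]
  rw [← FourierTransform.fourierInv_smul, ← FourierTransform.fourierInv_add]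
  congr 1
  ext η
  simp only [_root_.add_apply, _root_.smul_apply, smulLeftCLM_apply_apply h,
    smulLeftCLM_apply_apply h₁, smulLeftCLM_apply_apply h₂, hm, smul_eq_mul]
  ring

/-- full symbol -/
def fsym {n : ℕ} (Φ : Eu n → ℝ) (q : Eu n → ℂ) (τ : ℝ) (k : ℕ) (η : Eu n) : ℂ :=
  (Φ ((2 : ℝ) ^ (-(k : ℤ)) • (2 * π) • η) : ℂ) * q η *
    (((1 + ‖(2 * π) • η‖ ^ 2) ^ (τ / 2) : ℝ) : ℂ)

lemma bump_temp {n : ℕ} (Φ : Eu n → ℝ) (hΦ : IsLPBump Φ) : Φ.HasTemperateGrowth := by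
  obtain ⟨h1, h2, h3, h4⟩ := hΦ
  refine HasCompactSupport.hasTemperateGrowth ?_ h1
  apply HasCompactSupport.of_support_subset_isCompact (isCompact_closedBall (0 : Eu n) 2)
  intro η hη
  by_contra hc
  simp only [Metric.mem_closedBall, dist_zero_right, not_le] at hc
  exact hη (h4 η hc.le)

lemma smul_temp {n : ℕ} {F : Type*} [NormedAddCommGroup F] [NormedSpace ℝ F] (g : Eu n → F)
    (hg : g.HasTemperateGrowth) (c : ℝ) : (fun η => g (c • η)).HasTemperateGrowth :=
  hg.comp (c • ContinuousLinearMap.id ℝ (Eu n)).hasTemperateGrowth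

lemma ofReal_temp {n : ℕ} (g : Eu n → ℝ)
    (hg : g.HasTemperateGrowth) : (fun η => (g η : ℂ)).HasTemperateGrowth :=
  Function.HasTemperateGrowth.comp Function.Complex.hasTemperateGrowth_ofReal hg

lemma bracket_temp {n : ℕ} (τ : ℝ) : (fun η : Eu n =>
    (((1 + ‖(2 * π) • η‖ ^ 2) ^ (τ / 2) : ℝ) : ℂ)).HasTemperateGrowth := by
  refine ofReal_temp _ ?_
  exact smul_temp (fun η : Eu n => (1 + ‖η‖ ^ 2) ^ (τ / 2))
    (Function.hasTemperateGrowth_one_add_norm_sq_rpow _ _) _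

lemma bumpk_temp {n : ℕ} (Φ : Eu n → ℝ) (hΦ : IsLPBump Φ) (k : ℕ) : (fun η : Eu n =>
    (Φ ((2 : ℝ) ^ (-(k : ℤ)) • (2 * π) • η) : ℂ)).HasTemperateGrowth := by
  refine ofReal_temp _ ?_
  exact smul_temp (fun η => Φ ((2 : ℝ) ^ (-(k : ℤ)) • η)) (smul_temp _ (bump_temp Φ hΦ) _) _

lemma fsym_temp {n : ℕ} (Φ : Eu n → ℝ) (hΦ : IsLPBump Φ) (q : Eu n → ℂ)
    (hq : q.HasTemperateGrowth) (τ : ℝ) (k : ℕ) : (fsym Φ q τ k).HasTemperateGrowth :=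
  ((bumpk_temp Φ hΦ k).mul hq).mul (bracket_temp τ)

lemma bump_zero {n : ℕ} (Φ : Eu n → ℝ) (hΦ : IsLPBump Φ) (c : ℝ) (hc : 2 ≤ c) (η : Eu n)
    (hη : 1 ≤ ‖η‖) : Φ (c • η) = 0 := by
  apply hΦ.2.2.2
  rw [norm_smul, Real.norm_of_nonneg (by linarith)]
  nlinarith

lemma two_le_two_pi : 2 ≤ 2 * π := by linarith [pi_gt_three]

open scoped ContDiff in
lemma base_KB {n : ℕ} (a : ℝ) (ha : 0 ≤ a) (Φ : Eu n → ℝ) (hΦ : IsLPBump Φ) (q : Eu n → ℂ)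
    (hq : ContDiff ℝ ∞ q) (τ : ℝ) :
    ∃ C : ℝ, 0 ≤ C ∧ KB a (fourierMultiplierCLM ℂ (fsym Φ q τ 0)) (ENNReal.ofReal C) := by
  have h1 : ContDiff ℝ ∞ Φ := hΦ.1
  have ho : ContDiff ℝ ∞ (fun x : ℝ => (x : ℂ)) := ofRealCLM.contDiff
  have hs : ContDiff ℝ ∞ (fun p : ℝ × Eu n => fsym Φ q τ 0 p.2) := by
    have h2 : ContDiff ℝ ∞ (fun p : ℝ × Eu n =>
        (((1 + ‖(2 * π) • p.2‖ ^ 2) ^ (τ / 2) : ℝ) : ℂ)) := by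
      refine ho.comp ?_
      refine ContDiff.rpow_const_of_ne ?_ (fun p => by positivity)
      apply ContDiff.add (by fun_prop)
      apply ContDiff.norm_sq ℝ
      fun_prop
    unfold fsym
    fun_prop
  obtain ⟨m, hm, hb⟩ := bdd_family _ hs (fun ε η hη => by
    have := bump_zero Φ hΦ (2 * π) two_le_two_pi η hη
    simp [fsym, this])
  obtain ⟨C, hC, hCb⟩ := weight_bdd a ha _ hb
  refine ⟨C, hC, ?_⟩
  have := KB_dil a ha (m 0) 1 one_pos le_rfl (hCb _ ⟨0, by simp, rfl⟩)
  simpa [hm] using this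

open scoped ContDiff in
lemma main_symbol {n : ℕ} (a : ℝ) (ha : 0 ≤ a) (Φ : Eu n → ℝ) (hΦ : IsLPBump Φ) (q : Eu n → ℂ)
    (hq : ContDiff ℝ ∞ q) (hqT : q.HasTemperateGrowth) (d : ℕ)
    (hom : ∀ c : ℝ, 0 < c → ∀ η, q (c • η) = (c : ℂ) ^ d * q η) (τ σ : ℝ) (hσ : σ = d + τ)
    (hσ0 : 0 < σ) :
    ∃ C : ℝ, 0 < C ∧ ∀ k : ℕ,
      KB a (fourierMultiplierCLM ℂ (fsym Φ q τ k)) (ENNReal.ofReal (C * 2 ^ (k * σ))) := by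
  obtain ⟨C₀, hC₀, hK₀⟩ := base_KB a ha Φ hΦ q hq τ
  obtain ⟨m, hm, hb⟩ := bdd_family _ (dyadic_symbol Φ hΦ q hq τ) (fun ε η hη => by
    rw [bump_zero Φ hΦ (2 * π) two_le_two_pi η hη,
      bump_zero Φ hΦ (4 * π) (by linarith [two_le_two_pi]) η hη]
    simp)
  obtain ⟨C₁, hC₁, hCb⟩ := weight_bdd a ha _ hb
  have h2σ : 1 < (2 : ℝ) ^ σ := Real.one_lt_rpow (by norm_num) hσ0
  set D := C₁ * 2 ^ σ / (2 ^ σ - 1)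
  have hD : 0 ≤ D := div_nonneg (by positivity) (by linarith)
  have hDe : D + C₁ * 2 ^ σ = D * 2 ^ σ := by
    have : (2 : ℝ) ^ σ - 1 ≠ 0 := by linarith
    simp only [D]
    field_simp
    ring
  refine ⟨C₀ + D + 1, by positivity, fun k => ?_⟩
  induction k with
  | zero =>
    refine hK₀.mono (ENNReal.ofReal_le_ofReal ?_)
    simp; linarith
  | succ k ih =>
    set ε : ℝ := 2 ^ (-((k + 1 : ℕ) : ℤ)) with hε
    have hε0 : 0 < ε := by positivity
    have hε1 : ε ≤ 1 := by
      rw [hε, zpow_neg, zpow_natCast]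
      exact inv_le_one_of_one_le₀ (one_le_pow₀ (by norm_num))
    have hεk : (2 : ℝ) ^ (-(k : ℤ)) = 2 * ε := by
      rw [hε, zpow_neg, zpow_neg, zpow_natCast, zpow_natCast, pow_succ]
      field_simp
    have hεi : (2 : ℝ) ^ (((k + 1 : ℕ) : ℝ) * σ) = (ε⁻¹) ^ σ := by
      rw [Real.rpow_mul (by norm_num), Real.rpow_natCast, hε, zpow_neg, zpow_natCast, inv_inv]
    have hK := KB_dil a ha (m ε) ε hε0 hε1 (hCb _ ⟨ε, ⟨hε0.le, hε1⟩, rfl⟩)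
    have hT : (fun η => m ε (ε • η)).HasTemperateGrowth :=
      smul_temp _ (m ε).hasTemperateGrowth ε
    have hsum : ∀ η, fsym Φ q τ (k + 1) η =
        fsym Φ q τ k η + (((ε⁻¹) ^ σ : ℝ) : ℂ) * m ε (ε • η) := by
      intro η
      rw [hm]
      unfold fsym
      rw [hεk, ← hε, hom ε hε0]
      simp only [smul_smul]
      have e1 : 2 * π * ε = ε * (2 * π) := by ring
      have e2 : 4 * π * ε = 2 * ε * (2 * π) := by ring
      rw [e1, e2]
      have e3 : ε ^ 2 + ‖(ε * (2 * π)) • η‖ ^ 2 = ε ^ 2 * (1 + ‖(2 * π) • η‖ ^ 2) := by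
        rw [mul_smul, norm_smul ε, Real.norm_of_nonneg hε0.le]; ring
      have e4 : (ε⁻¹) ^ σ * ε ^ d * (ε ^ 2) ^ (τ / 2) = 1 := by
        rw [← Real.rpow_two, ← Real.rpow_mul hε0.le, ← Real.rpow_natCast, Real.inv_rpow hε0.le,
          mul_assoc, ← Real.rpow_add hε0, hσ]
        have : (d : ℝ) + 2 * (τ / 2) = d + τ := by ring
        rw [this]
        exact inv_mul_cancel₀ (by positivity)
      have e4' : (((ε⁻¹) ^ σ : ℝ) : ℂ) * (ε : ℂ) ^ d * (((ε ^ 2) ^ (τ / 2) : ℝ) : ℂ) = 1 := by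
        exact_mod_cast congrArg (fun t : ℝ => (t : ℂ)) e4
      rw [e3, Real.mul_rpow (by positivity) (by positivity)]
      push_cast only [Complex.ofReal_mul, Complex.ofReal_sub]
      linear_combination (-((Φ ((ε * (2 * π)) • η) : ℂ) - (Φ ((2 * ε * (2 * π)) • η) : ℂ)) * q η *
        (((1 + ‖(2 * π) • η‖ ^ 2) ^ (τ / 2) : ℝ) : ℂ)) * e4'
    have hadd := ih.add (hK.smul ((ε⁻¹) ^ σ) (by positivity)
      (R := fun f => (((ε⁻¹) ^ σ : ℝ) : ℂ) • fourierMultiplierCLM ℂ (fun η => m ε (ε • η)) f)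
      (fun f x => rfl)) (R := fourierMultiplierCLM ℂ (fsym Φ q τ (k + 1)))
      (fun f x => by
        rw [mult_add_smul (fsym_temp Φ hΦ q hqT τ k) hT _ hsum f]; rfl)
    refine hadd.mono ?_
    rw [← hεi, ← ENNReal.ofReal_mul (by positivity), ← ENNReal.ofReal_add (by positivity) (by positivity)]
    apply ENNReal.ofReal_le_ofReal
    have e5 : (2 : ℝ) ^ (((k + 1 : ℕ) : ℝ) * σ) = 2 ^ (k * σ) * 2 ^ σ := by
      rw [← Real.rpow_add (by norm_num)]; congr 1; push_cast; ring
    rw [e5]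
    have hX : (0 : ℝ) < 2 ^ (k * σ) := by positivity
    have : (C₀ + D + 1) + 2 ^ σ * C₁ ≤ (C₀ + D + 1) * 2 ^ σ := by nlinarith
    nlinarith

lemma FT_eq {n : ℕ} (f : 𝓢(Eu n, ℂ)) (v : Eu n) : (𝓕 f) v = FT f ((2 * π) • v) := by
  rw [fourier_coe, Real.fourier_eq]
  unfold FT
  congr 1
  ext x
  rw [Circle.smul_def, Real.fourierChar_apply, smul_eq_mul, mul_comm]
  congr 2
  rw [inner_smul_right]
  push_cast
  ring

lemma conv_op {n : ℕ} (m : Eu n → ℂ) (hm : (fun η => m ((2 * π) • η)).HasTemperateGrowth)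
    (f : 𝓢(Eu n, ℂ)) (x : Eu n) :
    ((((2 * Real.pi) ^ n)⁻¹ : ℝ) : ℂ) *
      ∫ ξ, m ξ * FT f ξ * Complex.exp (Complex.I * ((⟪x, ξ⟫ : ℝ) : ℂ)) =
    fourierMultiplierCLM ℂ (fun η => m ((2 * π) • η)) f x := by
  have h1 := Measure.integral_comp_smul (volume : Measure (Eu n))
    (fun ξ => m ξ * FT f ξ * Complex.exp (Complex.I * ((⟪x, ξ⟫ : ℝ) : ℂ))) (2 * π)
  simp only [finrank_euclideanSpace, Fintype.card_fin] at h1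
  rw [abs_of_pos (by positivity)] at h1
  rw [← Complex.real_smul, ← h1, fourierMultiplierCLM_apply, fourierInv_coe, Real.fourierInv_eq]
  congr 1
  ext v
  rw [smulLeftCLM_apply_apply hm, FT_eq, Circle.smul_def, Real.fourierChar_apply, smul_eq_mul,
    smul_eq_mul, mul_comm]
  congr 2
  rw [inner_smul_right, real_inner_comm]
  push_cast
  ring

lemma SProj_eq {n : ℕ} (Φ : Eu n → ℝ) (hΦ : IsLPBump Φ) (k : ℕ) (f : 𝓢(Eu n, ℂ)) :
    SProj Φ (k : ℤ) f = fourierMultiplierCLM ℂ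
      (fun η => (Φ ((2 : ℝ) ^ (-(k : ℤ)) • (2 * π) • η) : ℂ)) f := by
  ext x
  exact conv_op (fun ξ => (Φ ((2 : ℝ) ^ (-(k : ℤ)) • ξ) : ℂ)) (bumpk_temp Φ hΦ k) f x

lemma Js_eq {n : ℕ} (s : ℝ) (f : 𝓢(Eu n, ℂ)) :
    Js s f = fourierMultiplierCLM ℂ
      (fun η : Eu n => (((1 + ‖(2 * π) • η‖ ^ 2) ^ (s / 2) : ℝ) : ℂ)) f := by
  ext x
  exact conv_op (fun ξ => (((1 + ‖ξ‖ ^ 2) ^ (s / 2) : ℝ) : ℂ)) (bracket_temp s) f x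

lemma bump_KB {n : ℕ} (a : ℝ) (ha : 0 ≤ a) (Φ : Eu n → ℝ) (hΦ : IsLPBump Φ) :
    ∃ C : ℝ, 0 ≤ C ∧ ∀ k : ℕ, KB a (fourierMultiplierCLM ℂ
      (fun η => (Φ ((2 : ℝ) ^ (-(k : ℤ)) • (2 * π) • η) : ℂ))) (ENNReal.ofReal C) := by
  have h1 : ContDiff ℝ (⊤ : ℕ∞) Φ := hΦ.1
  have ho : ContDiff ℝ (⊤ : ℕ∞) (fun x : ℝ => (x : ℂ)) := ofRealCLM.contDiff
  obtain ⟨m, hm, hb⟩ := bdd_family (fun p : ℝ × Eu n => (Φ ((2 * π) • p.2) : ℂ)) (by fun_prop)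
    (fun ε η hη => by
      have := bump_zero Φ hΦ (2 * π) two_le_two_pi η hη
      simp [this])
  obtain ⟨C, hC, hCb⟩ := weight_bdd a ha _ hb
  refine ⟨C, hC, fun k => ?_⟩
  have := KB_dil a ha (m 0) (2 ^ (-(k : ℤ))) (by positivity) (by
    rw [zpow_neg, zpow_natCast]
    exact inv_le_one_of_one_le₀ (one_le_pow₀ (by norm_num))) (hCb _ ⟨0, by simp, rfl⟩)
  simp only [hm] at this
  simpa only [smul_comm (2 * π)] using this

lemma interp {S X Y : ℝ≥0∞} {c₁ c₂ θ : ℝ} (hθ0 : 0 < θ) (hθ1 : θ ≤ 1) {C L : ℝ}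
    (hC1 : c₁ ≤ C) (hC2 : c₂ ≤ C) (hC : 0 ≤ C) (hL : 0 ≤ L)
    (h1 : S ≤ ENNReal.ofReal (c₁ * L) * X) (h2 : S ≤ ENNReal.ofReal c₂ * Y) :
    S ≤ ENNReal.ofReal (C * L ^ θ) * X ^ θ * Y ^ (1 - θ) := by
  have h1' : S ≤ ENNReal.ofReal (C * L) * X := h1.trans (by gcongr)
  have h2' : S ≤ ENNReal.ofReal C * Y := h2.trans (by gcongr)
  calc S = S ^ θ * S ^ (1 - θ) := by
        rw [← ENNReal.rpow_add_of_nonneg _ _ hθ0.le (by linarith)]; simp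
    _ ≤ (ENNReal.ofReal (C * L) * X) ^ θ * (ENNReal.ofReal C * Y) ^ (1 - θ) := by
        gcongr
    _ = (ENNReal.ofReal (C * L) ^ θ * ENNReal.ofReal C ^ (1 - θ)) * X ^ θ * Y ^ (1 - θ) := by
        rw [ENNReal.mul_rpow_of_nonneg _ _ hθ0.le, ENNReal.mul_rpow_of_nonneg _ _ (by linarith)]
        ring
    _ = _ := by
        congr 2
        rw [ENNReal.ofReal_mul hC, ENNReal.mul_rpow_of_nonneg _ _ hθ0.le, mul_right_comm,
          ← ENNReal.rpow_add_of_nonneg _ _ hθ0.le (by linarith),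
          ENNReal.ofReal_rpow_of_nonneg hL hθ0.le, ENNReal.ofReal_mul hC]
        simp

lemma gradNorm_le {n : ℕ} (f : Eu n → ℂ) (x : Eu n) :
    ‖gradNorm f x‖ₑ ≤ ∑ j : Fin n, ‖fderiv ℝ f x (EuclideanSpace.single j 1)‖ₑ := by
  unfold gradNorm
  simp only [← ofReal_norm]
  rw [← ENNReal.ofReal_sum_of_nonneg (fun i _ => norm_nonneg _)]
  apply ENNReal.ofReal_le_ofReal
  rw [Real.norm_of_nonneg (Real.sqrt_nonneg _)]
  apply Real.sqrt_le_iff.2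
  refine ⟨Finset.sum_nonneg fun i _ => norm_nonneg _, ?_⟩
  exact Finset.sum_sq_le_sq_sum_of_nonneg (fun i _ => norm_nonneg _)

lemma le_gradNorm {n : ℕ} (f : Eu n → ℂ) (x : Eu n) (j : Fin n) :
    ‖fderiv ℝ f x (EuclideanSpace.single j 1)‖ₑ ≤ ‖gradNorm f x‖ₑ := by
  unfold gradNorm
  simp only [← ofReal_norm]
  apply ENNReal.ofReal_le_ofReal
  rw [Real.norm_of_nonneg (Real.sqrt_nonneg _)]
  apply Real.le_sqrt_of_sq_le
  exact Finset.single_le_sum (f := fun j => ‖fderiv ℝ f x (EuclideanSpace.single j 1)‖ ^ 2)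
    (fun i _ => by positivity) (Finset.mem_univ j)

lemma gradNorm_cont {n : ℕ} (f : 𝓢(Eu n, ℂ)) : Continuous (gradNorm f) := by
  have h : Continuous (fderiv ℝ f) := (f.smooth 1).continuous_fderiv (by norm_num)
  unfold gradNorm
  fun_prop

open LineDeriv in
lemma fderiv_mult {n : ℕ} (m : Eu n → ℂ) (hm : m.HasTemperateGrowth) (f : 𝓢(Eu n, ℂ))
    (v x : Eu n) :
    fderiv ℝ (fourierMultiplierCLM ℂ m f) x v =
      fourierMultiplierCLM ℂ (fun η => m η * (2 * π * Complex.I * ((inner ℝ η v : ℝ) : ℂ))) f x := by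
  have hi : (fun η : Eu n => ((inner ℝ η v : ℝ) : ℂ)).HasTemperateGrowth :=
    ofReal_temp _ (Function.hasTemperateGrowth_inner_left v)
  rw [← lineDerivOp_apply_eq_fderiv, lineDeriv_eq_fourierMultiplierCLM,
    ← fourierMultiplierCLM_ofReal ℂ (Function.hasTemperateGrowth_inner_left v)]
  change ((2 * π * Complex.I) • fourierMultiplierCLM ℂ (fun η : Eu n => ((inner ℝ η v : ℝ) : ℂ)) (fourierMultiplierCLM ℂ m f)) x = _
  rw [fourierMultiplierCLM_fourierMultiplierCLM_apply hi hm]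
  have := mult_add_smul (m := fun η => m η * (2 * π * Complex.I * ((inner ℝ η v : ℝ) : ℂ)))
    (m₁ := fun _ => 0) (m₂ := (fun η : Eu n => ((inner ℝ η v : ℝ) : ℂ)) * m)
    (Function.HasTemperateGrowth.const 0) (hi.mul hm) (2 * π * Complex.I)
    (fun η => by simp; ring) f
  rw [this]
  simp

lemma fderiv_mult' {n : ℕ} (m : Eu n → ℂ) (hm : m.HasTemperateGrowth) (f : 𝓢(Eu n, ℂ))
    (v x : Eu n) :
    fderiv ℝ (fourierMultiplierCLM ℂ m f) x v =
      fourierMultiplierCLM ℂ m (LineDeriv.lineDerivOp v f) x := by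
  have hi : (fun η : Eu n => ((inner ℝ η v : ℝ) : ℂ)).HasTemperateGrowth :=
    ofReal_temp _ (Function.hasTemperateGrowth_inner_left v)
  rw [← lineDerivOp_apply_eq_fderiv, lineDeriv_eq_fourierMultiplierCLM,
    lineDeriv_eq_fourierMultiplierCLM,
    ← fourierMultiplierCLM_ofReal ℂ (Function.hasTemperateGrowth_inner_left v),
    ← fourierMultiplierCLM_ofReal ℂ (Function.hasTemperateGrowth_inner_left v), map_smul]
  change ((2 * π * Complex.I) • fourierMultiplierCLM ℂ (fun η : Eu n => ((inner ℝ η v : ℝ) : ℂ)) (fourierMultiplierCLM ℂ m f)) x =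
    ((2 * π * Complex.I) • fourierMultiplierCLM ℂ m (fourierMultiplierCLM ℂ (fun η : Eu n => ((inner ℝ η v : ℝ) : ℂ)) f)) x
  rw [fourierMultiplierCLM_fourierMultiplierCLM_apply hi hm,
    fourierMultiplierCLM_fourierMultiplierCLM_apply hm hi, mul_comm m]

lemma grad_young {n : ℕ} {G : Type*} [NormedAddCommGroup G]
    (r : ℝ≥0∞) (hr : 1 ≤ r) (a : ℝ) (ha : 0 ≤ a) (g : Eu n → ℂ) (v : Eu n → G) (hv : Continuous v)
    (T : Fin n → 𝓢(Eu n, ℂ) → 𝓢(Eu n, ℂ)) (B : Fin n → ℝ) (hB0 : ∀ l, 0 ≤ B l)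
    (hB : ∀ l, KB a (T l) (ENNReal.ofReal (B l))) (h : Fin n → 𝓢(Eu n, ℂ))
    (hh : ∀ l y, ‖h l y‖ₑ ≤ ‖v y‖ₑ)
    (hg : ∀ l x, fderiv ℝ g x (EuclideanSpace.single l 1) = T l (h l) x) :
    wNorm r a (gradNorm g) ≤ ENNReal.ofReal (2 ^ (a / 2) * ∑ l, B l) * wNorm r a v := by
  choose A hA1 hA2 hA3 using hB
  have hjm := measurable_jweight (n := n) a
  have hV : Measurable fun y => ‖v y‖ₑ := hv.enorm.measurable
  have := young r hr a ha (gradNorm g) v hv (fun z => ∑ l, A l z) (by fun_prop) (fun x => by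
    refine (gradNorm_le g x).trans ?_
    simp only [Finset.sum_mul]
    have hVx : Measurable fun z => ‖v (x - z)‖ₑ := hV.comp (measurable_const.sub measurable_id)
    rw [lintegral_finsetSum _ (fun l _ => by fun_prop)]
    apply Finset.sum_le_sum
    intro l _
    rw [hg]
    refine (hA2 l (h l) x).trans (lintegral_mono fun z => ?_)
    exact mul_le_mul_right (hh l _) _)
  refine this.trans ?_
  gcongr
  rw [ENNReal.ofReal_mul (by positivity), ENNReal.ofReal_sum_of_nonneg (fun l _ => hB0 l)]
  gcongr
  simp only [Finset.sum_mul]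
  rw [lintegral_finsetSum _ (fun l _ => by fun_prop)]
  exact Finset.sum_le_sum fun l _ => hA3 l

lemma KB_young {n : ℕ} (r : ℝ≥0∞) (hr : 1 ≤ r) (a : ℝ) (ha : 0 ≤ a)
    {T : 𝓢(Eu n, ℂ) → 𝓢(Eu n, ℂ)} {B : ℝ} (hB : KB a T (ENNReal.ofReal B)) (h : 𝓢(Eu n, ℂ)) :
    wNorm r a (T h) ≤ ENNReal.ofReal (2 ^ (a / 2) * B) * wNorm r a h := by
  obtain ⟨A, h1, h2, h3⟩ := hB
  refine (young r hr a ha (T h) h h.continuous A h1 (h2 h)).trans ?_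
  rw [ENNReal.ofReal_mul (by positivity)]
  gcongr

lemma fsym_comp {n : ℕ} (Φ : Eu n → ℝ) (hΦ : IsLPBump Φ) (q : Eu n → ℂ)
    (hq : q.HasTemperateGrowth) (τ : ℝ) (k : ℕ) (f : 𝓢(Eu n, ℂ)) :
    fourierMultiplierCLM ℂ (fsym Φ q τ k) (fourierMultiplierCLM ℂ
      (fun η : Eu n => (((1 + ‖(2 * π) • η‖ ^ 2) ^ (-τ / 2) : ℝ) : ℂ)) f) =
    fourierMultiplierCLM ℂ (fun η => (Φ ((2 : ℝ) ^ (-(k : ℤ)) • (2 * π) • η) : ℂ) * q η) f := by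
  rw [fourierMultiplierCLM_fourierMultiplierCLM_apply (fsym_temp Φ hΦ q hq τ k) (bracket_temp _)]
  congr 2
  ext η
  simp only [fsym, Pi.mul_apply]
  rw [mul_assoc, ← Complex.ofReal_mul, ← Real.rpow_add (by positivity)]
  have : τ / 2 + -τ / 2 = 0 := by ring
  rw [this]; simp

/-- **Localized interpolation inequality** (Lemma 4.1). -/
theorem localized_interpolation (n : ℕ) (hn : 1 ≤ n) (s : ℝ) (hs0 : 0 ≤ s) (hs1 : s < 1)
    (r : ℝ≥0∞) (hr : 1 ≤ r) (a : ℝ) (ha : 0 ≤ a) (θ : ℝ) (hθ0 : 0 < θ) (hθ1 : θ ≤ 1)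
    (Φ : Eu n → ℝ) (hΦ : IsLPBump Φ) :
    ∃ C : ℝ, 0 < C ∧ ∀ k : ℕ, ∀ f : SchwartzMap (Eu n) ℂ,
      wNorm r a (SProj Φ (k : ℤ) ⇑f) ≤
        ENNReal.ofReal (C * 2 ^ ((k : ℝ) * θ * (1 - s))) *
          wNorm r a (Js (s - 1) ⇑f) ^ θ * wNorm r a ⇑f ^ (1 - θ) ∧
      wNorm r a (gradNorm (SProj Φ (k : ℤ) ⇑f)) ≤
        ENNReal.ofReal (C * 2 ^ ((k : ℝ) * θ * (1 - s))) *
          wNorm r a (Js s ⇑f) ^ θ * wNorm r a (gradNorm ⇑f) ^ (1 - θ) := by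
  set P : ℝ := 2 ^ (a / 2) with hP
  have hP0 : 0 < P := by positivity
  obtain ⟨Cb, hCb, hKb⟩ := bump_KB a ha Φ hΦ
  obtain ⟨C2, hC2, hK2⟩ := main_symbol a ha Φ hΦ (fun _ => 1) contDiff_const
    (Function.HasTemperateGrowth.const 1) 0 (by simp) (1 - s) (1 - s) (by simp) (by linarith)
  let e : Fin n → Eu n := fun l => EuclideanSpace.single l 1
  let q : Fin n → Eu n → ℂ := fun l η => 2 * π * Complex.I * ((inner ℝ η (e l) : ℝ) : ℂ)
  have hi : ∀ l, (fun η : Eu n => ((inner ℝ η (e l) : ℝ) : ℂ)).HasTemperateGrowth := fun l =>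
    ofReal_temp _ (Function.hasTemperateGrowth_inner_left (e l))
  have hq : ∀ l, (q l).HasTemperateGrowth := fun l =>
    (Function.HasTemperateGrowth.const _).mul (hi l)
  have h3 : ∀ l, ∃ C : ℝ, 0 < C ∧ ∀ k : ℕ,
      KB a (fourierMultiplierCLM ℂ (fsym Φ (q l) (-s) k)) (ENNReal.ofReal (C * 2 ^ (k * (1 - s)))) :=
    fun l => main_symbol a ha Φ hΦ (q l) (hq l).1 (hq l) 1 (fun c hc η => by
      simp only [q, inner_smul_left]
      simp; ring) (-s) (1 - s) (by push_cast; ring) (by linarith)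
  choose C3 hC3 hK3 using h3
  have hS3 : 0 ≤ ∑ l, C3 l := Finset.sum_nonneg fun l _ => (hC3 l).le
  refine ⟨P * Cb + P * C2 + P * (∑ _l : Fin n, Cb) + P * (∑ l, C3 l) + 1, by positivity,
    fun k f => ?_⟩
  have hA0 : 0 ≤ P * Cb := by positivity
  have hB0 : 0 ≤ P * C2 := by positivity
  have hD0 : 0 ≤ P * (∑ _l : Fin n, Cb) := by positivity
  have hE0 : 0 ≤ P * (∑ l, C3 l) := by positivity
  have hL : (2 : ℝ) ^ ((k : ℝ) * θ * (1 - s)) = (2 ^ ((k : ℝ) * (1 - s))) ^ θ := by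
    rw [← Real.rpow_mul (by norm_num)]; congr 1; ring
  rw [hL, SProj_eq Φ hΦ, Js_eq, Js_eq]
  constructor
  · refine interp (c₁ := P * C2) (c₂ := P * Cb) hθ0 hθ1 (by linarith) (by linarith) (by linarith)
      (by positivity) ?_ (KB_young r hr a ha (hKb k) f)
    have := KB_young r hr a ha (hK2 k) (fourierMultiplierCLM ℂ
      (fun η : Eu n => (((1 + ‖(2 * π) • η‖ ^ 2) ^ (-(1 - s) / 2) : ℝ) : ℂ)) f)
    rw [fsym_comp Φ hΦ _ (Function.HasTemperateGrowth.const 1)] at this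
    simpa only [mul_one, neg_sub, mul_assoc] using this
  · refine interp (c₁ := P * (∑ l, C3 l)) (c₂ := P * (∑ _l : Fin n, Cb)) hθ0 hθ1
      (by linarith) (by linarith) (by linarith) (by positivity) ?_ ?_
    · have := grad_young r hr a ha (fourierMultiplierCLM ℂ
        (fun η => (Φ ((2 : ℝ) ^ (-(k : ℤ)) • (2 * π) • η) : ℂ)) f)
        (fourierMultiplierCLM ℂ
          (fun η : Eu n => (((1 + ‖(2 * π) • η‖ ^ 2) ^ (s / 2) : ℝ) : ℂ)) f)
        (SchwartzMap.continuous _) (fun l => fourierMultiplierCLM ℂ (fsym Φ (q l) (-s) k))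
        (fun l => C3 l * 2 ^ (k * (1 - s))) (fun l => by have := hC3 l; positivity)
        (fun l => hK3 l k)
        (fun _ => fourierMultiplierCLM ℂ
          (fun η : Eu n => (((1 + ‖(2 * π) • η‖ ^ 2) ^ (s / 2) : ℝ) : ℂ)) f) (fun _ _ => le_rfl)
        (fun l x => by
          have h5 := fsym_comp Φ hΦ (q l) (hq l) (-s) k f
          rw [neg_neg] at h5
          rw [h5, fderiv_mult _ (bumpk_temp Φ hΦ k)])
      rwa [← Finset.sum_mul, ← mul_assoc] at this
    · exact grad_young r hr a ha _ (gradNorm f) (gradNorm_cont f) (fun _ => fourierMultiplierCLM ℂ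
        (fun η => (Φ ((2 : ℝ) ^ (-(k : ℤ)) • (2 * π) • η) : ℂ))) (fun _ => Cb) (fun _ => hCb)
        (fun _ => hKb k) (fun l => LineDeriv.lineDerivOp (e l) f)
        (fun l y => by
          rw [lineDerivOp_apply_eq_fderiv]
          exact le_gradNorm f y l)
        (fun l x => fderiv_mult' _ (bumpk_temp Φ hΦ k) f _ x)
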